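/- arXiv:1410.7150 — 3 statements merged into one kernel-verified Lean document; each statement's English description precedes it below -/
import Mathlib

section
/- Let p ≥ 3 be an integer. Then there exists a real number c such that both N(p,q)/q^{p−1} → c and Medim(p,q)/q^{p−1} → c as q → ∞ along integers q coprime to p; i.e. for every ε > 0 there is Q such that for all q ≥ Q with gcd(p,q) = 1 one has |N(p,q)/q^{p−1} − c| < ε and |Medim(p,q)/q^{p−1} − c| < ε. -/
/-- A numerical semigroup: a submonoid of (ℕ,+) with finite complement. -/
def IsNumericalSemigroup (H : Set ℕ) : Prop :=
  0 ∈ H ∧ (∀ a ∈ H, ∀ b ∈ H, a + b ∈ H) ∧ Hᶜ.Finite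

/-- The embedding dimension: cardinality of the minimal generating set
`(H∖{0}) ∖ ((H∖{0}) + (H∖{0}))`. -/
noncomputable def edim (H : Set ℕ) : ℕ :=
  ((H \ {0}) \ {n | ∃ a ∈ H \ {0}, ∃ b ∈ H \ {0}, n = a + b}).ncard

/-- The multiplicity: smallest positive element. -/
noncomputable def mult (H : Set ℕ) : ℕ := sInf {n | n ∈ H ∧ 0 < n}

/-- `N p q`: the number of numerical semigroups containing both `p` and `q`. -/
noncomputable def countNS (p q : ℕ) : ℕ :=
  {H : Set ℕ | IsNumericalSemigroup H ∧ p ∈ H ∧ q ∈ H}.ncard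

/-- `Medim p q`: the number of numerical semigroups of maximal embedding
dimension `p` (i.e. `m(H) = edim(H) = p`) containing `q`. -/
noncomputable def countMaxEdim (p q : ℕ) : ℕ :=
  {H : Set ℕ | IsNumericalSemigroup H ∧ mult H = p ∧ edim H = p ∧ q ∈ H}.ncard

open Filter Topology MeasureTheory Pointwise

/-! ### Superadditive quasiperiodic sequences -/

/-- Superadditive sequences `f` with `f (n + p) = f n + t`. -/
structure IsSuperadditiveQuasiperiodic {R : Type*} [AddMonoid R] [LE R] (p : ℕ) (t : R)
    (f : ℕ → R) : Prop where
  map_zero : f 0 = 0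
  map_add_period : ∀ n, f (n + p) = f n + t
  superadd : ∀ m n, f m + f n ≤ f (m + n)

/-- The extension of a family indexed by `1, …, p - 1` to a sequence vanishing at `0` and
satisfying `f (n + p) = f n + t`. -/
def quasiExt {R : Type*} [Semiring R] (p : ℕ) (t : R) (x : Finset.Ico 1 p → R) (n : ℕ) : R :=
  (if h : n % p ∈ Finset.Ico 1 p then x ⟨n % p, h⟩ else 0) + (n / p : ℕ) * t

section quasiExt

variable {R : Type*} [Semiring R] {p : ℕ} (t : R) (x : Finset.Ico 1 p → R)

lemma quasiExt_zero : quasiExt p t x 0 = 0 := by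
  simp [quasiExt]

lemma quasiExt_add_period (hp : 0 < p) (n : ℕ) :
    quasiExt p t x (n + p) = quasiExt p t x n + t := by
  simp only [quasiExt, Nat.add_mod_right, Nat.add_div_right n hp,
    Nat.cast_add, Nat.cast_one, add_mul, one_mul, add_assoc]

lemma quasiExt_coe (i : Finset.Ico 1 p) : quasiExt p t x i = x i := by
  have hi := Finset.mem_Ico.1 i.2
  have hmod : (i : ℕ) % p = i := Nat.mod_eq_of_lt hi.2
  simp only [quasiExt, Nat.div_eq_of_lt hi.2, hmod, Nat.cast_zero, zero_mul, add_zero]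
  simp

end quasiExt

lemma map_add_mul_of_map_add_period {R : Type*} [Semiring R] {p : ℕ} {t : R} {f : ℕ → R}
    (hf : ∀ n, f (n + p) = f n + t) (n k : ℕ) : f (n + p * k) = f n + k * t := by
  induction k with
  | zero => simp
  | succ k ih => rw [mul_add, mul_one, ← add_assoc, hf, ih]; push_cast; rw [add_mul, one_mul,
      add_assoc]

lemma quasiExt_restrict {R : Type*} [Semiring R] {p : ℕ} (hp : 0 < p) {t : R} {f : ℕ → R}
    (h0 : f 0 = 0) (hf : ∀ n, f (n + p) = f n + t) :
    quasiExt p t (fun i : Finset.Ico 1 p => f i) = f := by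
  funext n
  conv_rhs => rw [← Nat.mod_add_div n p, map_add_mul_of_map_add_period hf]
  have hlt := Nat.mod_lt n hp
  rw [quasiExt]
  split_ifs with h
  · rfl
  · have : n % p = 0 := by
      by_contra hne
      exact h (Finset.mem_Ico.2 ⟨Nat.one_le_iff_ne_zero.2 hne, hlt⟩)
    rw [this, h0]

lemma cast_quasiExt {p q : ℕ} (m : Finset.Ico 1 p → ℕ) (x : Finset.Ico 1 p → ℝ)
    (h : ∀ i, (m i : ℝ) = q * x i) (n : ℕ) :
    ((quasiExt p q m n : ℕ) : ℝ) = q * quasiExt p 1 x n := by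
  unfold quasiExt
  split_ifs with hn
  · push_cast; rw [h]; ring
  · push_cast; ring

/-! ### Numerical semigroups containing two coprime integers -/

namespace IsNumericalSemigroup

variable {H : Set ℕ} {p q : ℕ}

lemma mul_mem (hH : IsNumericalSemigroup H) {a : ℕ} (ha : a ∈ H) (k : ℕ) : a * k ∈ H := by
  induction k with
  | zero => exact hH.1
  | succ k ih => exact hH.2.1 _ ih _ ha

lemma exists_mem_mod (hH : IsNumericalSemigroup H) (hp : 0 < p) {i : ℕ} (hi : i < p) :
    ∃ h ∈ H, h % p = i := by
  by_contra! hcon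
  refine Set.infinite_of_injective_forall_mem (f := fun k : ℕ => i + p * k) ?_ ?_ hH.2.2
  · intro a b hab
    simpa [hp.ne'] using hab
  · intro k hk
    exact hcon _ hk (by rw [Nat.add_mul_mod_self_left, Nat.mod_eq_of_lt hi])

end IsNumericalSemigroup

lemma exists_add_mul_eq_mul {p q : ℕ} (hq : 0 < q) (hp : 0 < p) (hpq : p.Coprime q) (m : ℕ) :
    ∃ n k, m + p * k = n * q := by
  obtain ⟨b, hb⟩ : ∃ b, q * b ≡ m [MOD p] := by
    obtain ⟨b, hb⟩ := Nat.exists_mul_mod_eq_of_coprime m hpq.symm hp.ne'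
    exact ⟨b, hb.2⟩
  refine ⟨b + p * m, ?_⟩
  have h1 : m ≤ (b + p * m) * q := by
    nlinarith [Nat.zero_le (b * q), Nat.mul_le_mul (Nat.mul_le_mul hp (le_refl m)) hq]
  have h2 : m ≡ (b + p * m) * q [MOD p] := by
    have : (b + p * m) * q = q * b + p * (m * q) := by ring
    rw [this, Nat.ModEq, Nat.add_mul_mod_self_left]
    exact hb.symm
  obtain ⟨k, hk⟩ := (Nat.modEq_iff_dvd' h1).1 h2
  exact ⟨k, by omega⟩

/-- The semigroup attached to a sequence `f`. -/
def semigroupOfSeq (p q : ℕ) (f : ℕ → ℕ) : Set ℕ :=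
  {m | ∃ n k, k ≤ f n ∧ m + p * k = n * q}

lemma isNumericalSemigroup_semigroupOfSeq {p q : ℕ} (hq : 0 < q)
    (hpq : p.Coprime q) {f : ℕ → ℕ} (hf : IsSuperadditiveQuasiperiodic p q f) :
    IsNumericalSemigroup (semigroupOfSeq p q f) ∧ p ∈ semigroupOfSeq p q f ∧
      q ∈ semigroupOfSeq p q f := by
  have h0 : 0 ∈ semigroupOfSeq p q f := ⟨0, 0, by simp, by simp⟩
  have hadd : ∀ a ∈ semigroupOfSeq p q f, ∀ b ∈ semigroupOfSeq p q f,
      a + b ∈ semigroupOfSeq p q f := by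
    rintro a ⟨n, k, hk, h⟩ b ⟨n', k', hk', h'⟩
    exact ⟨n + n', k + k', (add_le_add hk hk').trans (hf.superadd _ _), by linarith⟩
  have hpm : p ∈ semigroupOfSeq p q f := by
    refine ⟨p, q - 1, ?_, ?_⟩
    · have := hf.map_add_period 0
      rw [zero_add, hf.map_zero] at this
      omega
    · obtain ⟨r, rfl⟩ : ∃ r, q = r + 1 := ⟨q - 1, by omega⟩
      simp; ring
  have hqm : q ∈ semigroupOfSeq p q f := ⟨1, 0, by simp, by simp⟩
  refine ⟨⟨h0, hadd, ?_⟩, hpm, hqm⟩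
  have hmul : ∀ a ∈ semigroupOfSeq p q f, ∀ k : ℕ, k * a ∈ semigroupOfSeq p q f := by
    intro a ha k
    induction k with
    | zero => simpa using h0
    | succ k ih => rw [add_mul, one_mul]; exact hadd _ ih _ ha
  refine (Set.finite_lt_nat (p * q)).subset fun m hm => ?_
  by_contra hlt
  have hle : p * q ≤ m := not_lt.1 hlt
  obtain ⟨a, b, hab⟩ := Nat.exists_add_mul_eq_of_gcd_dvd_of_mul_pred_le p q m
    (by rw [hpq.gcd_eq_one]; exact one_dvd _)
    ((Nat.mul_le_mul (Nat.pred_le p) (Nat.pred_le q)).trans hle)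
  exact hm (hab ▸ hadd _ (hmul _ hpm a) _ (hmul _ hqm b))

lemma le_of_mem_semigroupOfSeq {p q : ℕ} (hp : 0 < p)
    (hpq : p.Coprime q) {f : ℕ → ℕ} (hf : IsSuperadditiveQuasiperiodic p q f) {m n k : ℕ}
    (hm : m ∈ semigroupOfSeq p q f) (h : m + p * k = n * q) : k ≤ f n := by
  obtain ⟨n', k', hk', h'⟩ := hm
  have hper := map_add_mul_of_map_add_period hf.map_add_period
  have hmod : n ≡ n' [MOD p] := by
    refine Nat.ModEq.cancel_right_of_coprime hpq.gcd_eq_one ?_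
    rw [← h, ← h', Nat.ModEq, Nat.add_mul_mod_self_left, Nat.add_mul_mod_self_left]
  rcases le_total n n' with hnn | hnn
  · obtain ⟨s, hs⟩ := (Nat.modEq_iff_dvd' hnn).1 hmod
    obtain rfl : n' = n + p * s := by omega
    have := hper n s
    have hk : k' = k + s * q := Nat.eq_of_mul_eq_mul_left hp (by nlinarith)
    simp only [Nat.cast_id] at this
    omega
  · obtain ⟨s, hs⟩ := (Nat.modEq_iff_dvd' hnn).1 hmod.symm
    obtain rfl : n = n' + p * s := by omega
    have := hper n' s
    have hk : k = k' + s * q := Nat.eq_of_mul_eq_mul_left hp (by nlinarith)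
    simp only [Nat.cast_id] at this
    omega

lemma exists_semigroupOfSeq_eq {p q : ℕ} (hp : 0 < p) (hq : 0 < q) (hpq : p.Coprime q)
    {H : Set ℕ} (hH : IsNumericalSemigroup H) (hpH : p ∈ H) (hqH : q ∈ H) :
    ∃ f, IsSuperadditiveQuasiperiodic p q f ∧ semigroupOfSeq p q f = H := by
  classical
  have key : ∀ n, ∃ k, (∃ m ∈ H, m + p * k = n * q) ∧
      ∀ k', (∃ m ∈ H, m + p * k' = n * q) → k' ≤ k := by
    intro n
    have hb : ∀ k, (∃ m ∈ H, m + p * k = n * q) → k ≤ n * q := by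
      rintro k ⟨m, -, hm⟩
      nlinarith [Nat.mul_le_mul hp (le_refl k)]
    have h0 : ∃ m ∈ H, m + p * 0 = n * q := ⟨q * n, hH.mul_mem hqH n, by ring⟩
    exact ⟨Nat.findGreatest (fun k => ∃ m ∈ H, m + p * k = n * q) (n * q),
      Nat.findGreatest_spec (P := fun k => ∃ m ∈ H, m + p * k = n * q) (Nat.zero_le _) h0,
      fun k' hk' => Nat.le_findGreatest (hb k' hk') hk'⟩
  choose f hmem hmax using key
  refine ⟨f, ⟨?_, ?_, ?_⟩, ?_⟩
  · obtain ⟨m, -, hm⟩ := hmem 0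
    have : p * f 0 = 0 := by omega
    simpa [hp.ne'] using this
  · intro n
    apply le_antisymm
    · obtain ⟨m, hm, h⟩ := hmem (n + p)
      by_cases hlt : f (n + p) ≤ q
      · exact hlt.trans (Nat.le_add_left _ _)
      · obtain ⟨r, hr⟩ := Nat.exists_eq_add_of_le (not_le.1 hlt).le
        have : r ≤ f n := hmax n r ⟨m, hm, by rw [hr] at h; nlinarith⟩
        omega
    · obtain ⟨m, hm, h⟩ := hmem n
      exact hmax (n + p) _ ⟨m, hm, by linarith⟩
  · intro m n
    obtain ⟨a, ha, h⟩ := hmem m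
    obtain ⟨b, hb, h'⟩ := hmem n
    exact hmax _ _ ⟨a + b, hH.2.1 _ ha _ hb, by linarith⟩
  · ext m
    constructor
    · rintro ⟨n, k, hk, h⟩
      obtain ⟨m', hm', h'⟩ := hmem n
      obtain ⟨r, hr⟩ := Nat.exists_eq_add_of_le hk
      have : m = m' + p * r := by rw [hr] at h'; linarith
      rw [this]
      exact hH.2.1 _ hm' _ (hH.mul_mem hpH r)
    · intro hm
      obtain ⟨n, k, h⟩ := exists_add_mul_eq_mul hq hp hpq m
      exact ⟨n, k, hmax n k ⟨m, hm, h⟩, h⟩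

lemma countNS_eq_ncard {p q : ℕ} (hp : 0 < p) (hq : 0 < q) (hpq : p.Coprime q) :
    countNS p q = {f : ℕ → ℕ | IsSuperadditiveQuasiperiodic p q f}.ncard := by
  symm
  refine Set.BijOn.ncard_eq (f := semigroupOfSeq p q) ⟨?_, ?_, ?_⟩
  · exact fun f hf => isNumericalSemigroup_semigroupOfSeq hq hpq hf
  · have aux : ∀ f g : ℕ → ℕ, IsSuperadditiveQuasiperiodic p q f →
        IsSuperadditiveQuasiperiodic p q g → semigroupOfSeq p q f = semigroupOfSeq p q g →
        ∀ n, f n ≤ g n := by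
      intro f g hf hg h n
      have hle : p * f n ≤ n * q := by
        have h1 : ∀ k : ℕ, k * f n ≤ f (k * n) := by
          intro k
          induction k with
          | zero => simp
          | succ k ih => rw [add_mul, add_mul, one_mul, one_mul]
                         exact (Nat.add_le_add_right ih _).trans (hf.superadd _ _)
        have h2 := map_add_mul_of_map_add_period hf.map_add_period 0 n
        rw [zero_add, hf.map_zero, zero_add] at h2
        simpa [h2] using h1 p
      have hmem : n * q - p * f n ∈ semigroupOfSeq p q f := ⟨n, f n, le_rfl, by omega⟩
      exact le_of_mem_semigroupOfSeq hp hpq hg (h ▸ hmem) (by omega)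
    exact fun f hf g hg h => funext fun n =>
      le_antisymm (aux f g hf hg h n) (aux g f hg hf h.symm n)
  · rintro H ⟨hH, hpH, hqH⟩
    obtain ⟨f, hf, hfH⟩ := exists_semigroupOfSeq_eq hp hq hpq hH hpH hqH
    exact ⟨f, hf, hfH⟩

/-! ### Counting lattice points -/

/-- The polytope whose dilates contain one lattice point for each numerical semigroup containing
two given coprime integers. -/
def kunzPolytope (p : ℕ) : Set (Finset.Ico 1 p → ℝ) :=
  {x | 0 ≤ quasiExt p 1 x 1 ∧
    ∀ m n, quasiExt p 1 x m + quasiExt p 1 x n ≤ quasiExt p 1 x (m + n)}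

lemma continuous_quasiExt (p n : ℕ) : Continuous fun x : Finset.Ico 1 p → ℝ =>
    quasiExt p 1 x n := by
  unfold quasiExt
  split_ifs <;> fun_prop

lemma isClosed_kunzPolytope (p : ℕ) : IsClosed (kunzPolytope p) := by
  have h : kunzPolytope p = {x | 0 ≤ quasiExt p 1 x 1} ∩ ⋂ m, ⋂ n,
      {x | quasiExt p 1 x m + quasiExt p 1 x n ≤ quasiExt p 1 x (m + n)} := by
    ext x; simp [kunzPolytope]
  rw [h]
  exact (isClosed_le continuous_const (continuous_quasiExt p 1)).inter
    (isClosed_iInter fun m => isClosed_iInter fun n => isClosed_le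
      ((continuous_quasiExt p m).add (continuous_quasiExt p n)) (continuous_quasiExt p _))

lemma quasiExt_convexComb {p : ℕ} {a b : ℝ} (hab : a + b = 1) (x y : Finset.Ico 1 p → ℝ) (n : ℕ) :
    quasiExt p 1 (a • x + b • y) n = a * quasiExt p 1 x n + b * quasiExt p 1 y n := by
  obtain rfl : b = 1 - a := by linarith
  unfold quasiExt
  split_ifs
  · simp only [Pi.add_apply, Pi.smul_apply, smul_eq_mul]; ring
  · ring

lemma convex_kunzPolytope (p : ℕ) : Convex ℝ (kunzPolytope p) := by
  rintro x ⟨hx, hx'⟩ y ⟨hy, hy'⟩ a b ha hb hab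
  refine ⟨?_, fun m n => ?_⟩
  · rw [quasiExt_convexComb hab]
    positivity
  · simp only [quasiExt_convexComb hab]
    nlinarith [mul_le_mul_of_nonneg_left (hx' m n) ha, mul_le_mul_of_nonneg_left (hy' m n) hb]

lemma nonneg_and_le_one_of_mem_kunzPolytope {p : ℕ} {x : Finset.Ico 1 p → ℝ}
    (hx : x ∈ kunzPolytope p) (i : Finset.Ico 1 p) : 0 ≤ x i ∧ x i ≤ 1 := by
  obtain ⟨h1, hadd⟩ := hx
  have hi := Finset.mem_Ico.1 i.2
  have hp : 0 < p := by omega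
  have hmul : ∀ n k : ℕ, k * quasiExt p 1 x n ≤ quasiExt p 1 x (k * n) := by
    intro n k
    induction k with
    | zero => simp [quasiExt_zero]
    | succ k ih =>
      have := hadd (k * n) n
      rw [← Nat.succ_mul] at this
      push_cast
      linarith
  have h2 := map_add_mul_of_map_add_period (quasiExt_add_period (1 : ℝ) x hp) 0 i
  rw [quasiExt_zero, zero_add, zero_add, mul_one] at h2
  have h3 := hmul i p
  have h4 := hmul 1 i
  rw [h2, quasiExt_coe] at h3
  rw [mul_one, quasiExt_coe] at h4
  have hp' : (0 : ℝ) < p := by exact_mod_cast hp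
  have hip : ((i : ℕ) : ℝ) ≤ p := by exact_mod_cast hi.2.le
  refine ⟨le_trans (by positivity) h4, ?_⟩
  by_contra! hlt
  nlinarith

lemma isBounded_kunzPolytope (p : ℕ) : Bornology.IsBounded (kunzPolytope p) :=
  (Metric.isBounded_Icc (0 : Finset.Ico 1 p → ℝ) 1).subset fun _ hx =>
    ⟨fun i => (nonneg_and_le_one_of_mem_kunzPolytope hx i).1,
      fun i => (nonneg_and_le_one_of_mem_kunzPolytope hx i).2⟩

lemma mem_inv_smul_span_basisFun_iff {ι : Type*} [Fintype ι] {q : ℕ} (hq : 0 < q) (x : ι → ℝ) :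
    x ∈ (q : ℝ)⁻¹ • (Submodule.span ℤ (Set.range (Pi.basisFun ℝ ι)) : Set (ι → ℝ)) ↔
      ∀ i, ∃ z : ℤ, (z : ℝ) = q * x i := by
  have hq' : (q : ℝ) ≠ 0 := by positivity
  rw [Set.mem_inv_smul_set_iff₀ hq', SetLike.mem_coe, Module.Basis.mem_span_iff_repr_mem]
  simp

lemma ncard_eq_card_inter_kunzPolytope {p q : ℕ} (hp : 2 ≤ p) (hq : 0 < q) :
    {f : ℕ → ℕ | IsSuperadditiveQuasiperiodic p q f}.ncard =
      Nat.card ↑(kunzPolytope p ∩ (q : ℝ)⁻¹ •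
        (Submodule.span ℤ (Set.range (Pi.basisFun ℝ (Finset.Ico 1 p))) :
          Set (Finset.Ico 1 p → ℝ))) := by
  have hp0 : 0 < p := by omega
  have hq' : (0 : ℝ) < q := by exact_mod_cast hq
  rw [Nat.card_coe_set_eq]
  refine Set.BijOn.ncard_eq (f := fun f i => (f i : ℝ) / q) ⟨?_, ?_, ?_⟩
  · intro f hf
    have hext : ∀ n, (f n : ℝ) = q * quasiExt p 1 (fun i : Finset.Ico 1 p => (f i : ℝ) / q) n := by
      intro n
      rw [← cast_quasiExt (fun i : Finset.Ico 1 p => f i) _ (fun i => by field_simp)]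
      have := congrFun (quasiExt_restrict hp0 hf.map_zero hf.map_add_period) n
      exact_mod_cast this.symm
    refine ⟨⟨?_, fun m n => ?_⟩, ?_⟩
    · have := hext 1
      exact nonneg_of_mul_nonneg_right (this ▸ Nat.cast_nonneg (f 1)) hq'
    · refine le_of_mul_le_mul_left ?_ hq'
      rw [mul_add, ← hext, ← hext, ← hext]
      exact_mod_cast hf.superadd m n
    · rw [mem_inv_smul_span_basisFun_iff hq]
      exact fun i => ⟨f i, by push_cast; field_simp⟩
  · intro f hf g hg h
    rw [← quasiExt_restrict hp0 hf.map_zero hf.map_add_period,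
      ← quasiExt_restrict hp0 hg.map_zero hg.map_add_period]
    congr 1
    funext i
    have := congrFun h i
    simp only at this
    field_simp at this
    exact_mod_cast this
  · rintro x ⟨hx, hx'⟩
    rw [mem_inv_smul_span_basisFun_iff hq] at hx'
    have hnat : ∀ i, ∃ m : ℕ, (m : ℝ) = q * x i := by
      intro i
      obtain ⟨z, hz⟩ := hx' i
      have h0 := (nonneg_and_le_one_of_mem_kunzPolytope hx i).1
      have hz0 : 0 ≤ z := by
        have : (0 : ℝ) ≤ z := by rw [hz]; positivity
        exact_mod_cast this
      lift z to ℕ using hz0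
      exact ⟨z, by exact_mod_cast hz⟩
    choose m hm using hnat
    refine ⟨quasiExt p q m, ⟨quasiExt_zero _ _, quasiExt_add_period _ _ hp0, ?_⟩, ?_⟩
    · intro a b
      have : (q : ℝ) * (quasiExt p 1 x a + quasiExt p 1 x b) ≤ q * quasiExt p 1 x (a + b) :=
        mul_le_mul_of_nonneg_left (hx.2 a b) hq'.le
      rw [mul_add, ← cast_quasiExt m x hm, ← cast_quasiExt m x hm, ← cast_quasiExt m x hm] at this
      exact_mod_cast this
    · funext i
      simp only [quasiExt_coe]
      rw [hm]
      field_simp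

lemma tendsto_ncard_div_pow {p : ℕ} (hp : 2 ≤ p) :
    Tendsto (fun q : ℕ => ({f : ℕ → ℕ | IsSuperadditiveQuasiperiodic p q f}.ncard : ℝ) /
      (q : ℝ) ^ (p - 1)) atTop (𝓝 (volume.real (kunzPolytope p))) := by
  have h := tendsto_card_div_pow_atTop_volume (kunzPolytope p) (isBounded_kunzPolytope p)
    (isClosed_kunzPolytope p).measurableSet ((convex_kunzPolytope p).addHaar_frontier volume)
  refine h.congr' ?_
  filter_upwards [eventually_gt_atTop 0] with q hq
  rw [ncard_eq_card_inter_kunzPolytope hp hq, Fintype.card_coe, Nat.card_Ico]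

/-! ### Maximal embedding dimension -/

/-- The minimal generators of a numerical semigroup. -/
def minimalGenerators (H : Set ℕ) : Set ℕ :=
  (H \ {0}) \ {n | ∃ a ∈ H \ {0}, ∃ b ∈ H \ {0}, n = a + b}

lemma edim_eq_iff {H : Set ℕ} {p : ℕ} (hp : 0 < p) (hH : IsNumericalSemigroup H) (hpH : p ∈ H) :
    edim H = p ↔ ∀ i < p, ∃ g ∈ minimalGenerators H, g % p = i := by
  have hinj : Set.InjOn (· % p) (minimalGenerators H) := by
    have aux : ∀ a ∈ minimalGenerators H, ∀ b ∈ minimalGenerators H, a % p = b % p → ¬ a < b := by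
      intro a ha b hb hab hlt
      obtain ⟨k, hk⟩ := (Nat.modEq_iff_dvd' hlt.le).1 hab
      exact hb.2 ⟨a, ha.1, p * k, ⟨hH.mul_mem hpH k, by
        rw [Set.mem_singleton_iff]; omega⟩, by omega⟩
    intro a ha b hb hab
    have h1 := aux a ha b hb hab
    have h2 := aux b hb a ha hab.symm
    omega
  have hsub : (· % p) '' minimalGenerators H ⊆ Set.Iio p := by
    rintro _ ⟨a, -, rfl⟩
    exact Nat.mod_lt a hp
  have hcard : edim H = ((· % p) '' minimalGenerators H).ncard := hinj.ncard_image.symm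
  have hIio : (Set.Iio p).ncard = p := by simp
  rw [hcard]
  constructor
  · intro h i hi
    have := Set.eq_of_subset_of_ncard_le hsub (by rw [h, hIio]) (Set.finite_Iio p)
    rw [← Set.mem_Iio, ← this] at hi
    exact hi
  · intro h
    rw [hsub.antisymm (fun i hi => h i hi), hIio]

lemma mult_mem {H : Set ℕ} {p : ℕ} (hp : 0 < p) (h : mult H = p) : p ∈ H := by
  have hne : {n | n ∈ H ∧ 0 < n}.Nonempty := by
    by_contra hcon
    rw [Set.not_nonempty_iff_eq_empty] at hcon
    rw [mult, hcon, Nat.sInf_empty] at h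
    omega
  exact h ▸ (Nat.sInf_mem hne).1

/-- Shifting down by `p` identifies the semigroups of maximal embedding dimension `p` with the
semigroups containing `p`. -/
lemma countMaxEdim_eq_countNS {p q : ℕ} (hp : 0 < p) (hq : p ≤ q) :
    countMaxEdim p q = countNS p (q - p) := by
  refine Set.BijOn.ncard_eq (f := fun H => {n | n + p ∈ H}) ⟨?_, ?_, ?_⟩
  · rintro H ⟨hH, hm, he, hqH⟩
    have hpH := mult_mem hp hm
    have hgen := (edim_eq_iff hp hH hpH).1 he
    refine ⟨⟨by simpa using hpH, ?_, ?_⟩, hH.2.1 _ hpH _ hpH, ?_⟩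
    · intro a ha b hb
      simp only [Set.mem_ofPred_eq] at ha hb ⊢
      obtain ⟨g, hg, hgm⟩ := hgen ((a + p + (b + p)) % p) (Nat.mod_lt _ hp)
      have ha' : a + p ∈ H \ {0} := ⟨ha, by simp; omega⟩
      rcases lt_or_ge g (a + p + (b + p)) with hlt | hge
      · obtain ⟨k, hk⟩ := (Nat.modEq_iff_dvd' hlt.le).1 hgm
        obtain ⟨r, rfl⟩ : ∃ r, k = r + 1 := ⟨k - 1, by
          have : k ≠ 0 := by rintro rfl; omega
          omega⟩
        have : a + b + p = g + p * r := by rw [mul_add] at hk; omega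
        rw [this]
        exact hH.2.1 _ hg.1.1 _ (hH.mul_mem hpH r)
      · obtain ⟨k, hk⟩ := (Nat.modEq_iff_dvd' hge).1 hgm.symm
        exact absurd ⟨a + p, ha', b + p + p * k, ⟨hH.2.1 _ hb _ (hH.mul_mem hpH k),
          by simp; omega⟩, by omega⟩ hg.2
    · exact hH.2.2.preimage (add_left_injective p).injOn
    · simpa [Nat.sub_add_cancel hq] using hqH
  · rintro H ⟨hH, hm, -, -⟩ K ⟨hK, hm', -, -⟩ h
    have aux : ∀ H K : Set ℕ, IsNumericalSemigroup K → mult H = p →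
        {n | n + p ∈ H} = {n | n + p ∈ K} → H ⊆ K := by
      intro H K hK hm h a ha
      rcases Nat.eq_zero_or_pos a with rfl | h0
      · exact hK.1
      · have hle : p ≤ a := hm ▸ Nat.sInf_le ⟨ha, h0⟩
        have : a - p ∈ {n | n + p ∈ H} := by simpa [Nat.sub_add_cancel hle] using ha
        rw [h] at this
        simpa [Nat.sub_add_cancel hle] using this
    exact (aux H K hK hm h).antisymm (aux K H hH hm' h.symm)
  · rintro K ⟨hK, hpK, hqK⟩
    set H : Set ℕ := {n | n = 0 ∨ ∃ k ∈ K, n = k + p} with hHdef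
    have hadd : ∀ a ∈ H, ∀ b ∈ H, a + b ∈ H := by
      rintro a (rfl | ⟨k, hk, rfl⟩) b (rfl | ⟨l, hl, rfl⟩)
      · exact Or.inl rfl
      · exact Or.inr ⟨l, hl, by omega⟩
      · exact Or.inr ⟨k, hk, by omega⟩
      · exact Or.inr ⟨k + l + p, hK.2.1 _ (hK.2.1 _ hk _ hl) _ hpK, by omega⟩
    have hpH : p ∈ H := Or.inr ⟨0, hK.1, by omega⟩
    have hH : IsNumericalSemigroup H := by
      refine ⟨Or.inl rfl, hadd, ?_⟩
      refine ((Set.finite_lt_nat p).union (hK.2.2.image (· + p))).subset fun n hn => ?_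
      rcases lt_or_ge n p with hlt | hge
      · exact Or.inl hlt
      · exact Or.inr ⟨n - p, fun hmem => hn (Or.inr ⟨n - p, hmem, by omega⟩), by simp; omega⟩
    refine ⟨H, ⟨hH, ?_, ?_, ?_⟩, ?_⟩
    · refine le_antisymm (Nat.sInf_le ⟨hpH, hp⟩) (le_csInf ⟨p, hpH, hp⟩ ?_)
      rintro b ⟨rfl | ⟨k, -, rfl⟩, hb⟩ <;> omega
    · rw [edim_eq_iff hp hH hpH]
      intro i hi
      classical
      have hex := hK.exists_mem_mod hp hi
      have hspec := Nat.find_spec hex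
      refine ⟨Nat.find hex + p, ⟨⟨Or.inr ⟨_, hspec.1, rfl⟩, by simp; omega⟩, ?_⟩, by
        rw [Nat.add_mod_right]; exact hspec.2⟩
      rintro ⟨a, ⟨rfl | ⟨k, hk, rfl⟩, ha⟩, b, ⟨rfl | ⟨l, hl, rfl⟩, hb⟩, hab⟩
      · exact ha rfl
      · exact ha rfl
      · exact hb rfl
      · have hkl : Nat.find hex = k + l + p := by omega
        refine Nat.find_min hex (m := k + l) (by omega) ⟨hK.2.1 _ hk _ hl, ?_⟩
        rw [← hspec.2, hkl, Nat.add_mod_right]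
    · exact Or.inr ⟨q - p, hqK, by omega⟩
    · ext n
      constructor
      · rintro (h | ⟨k, hk, h⟩)
        · omega
        · obtain rfl : n = k := by omega
          exact hk
      · exact fun hn => Or.inr ⟨n, hn, rfl⟩

/-- `N(p,q)/q^(p-1)` and `Medim(p,q)/q^(p-1)` converge to a common limit as
`q → ∞` along integers coprime to `p`. -/
theorem countNS_countMaxEdim_asymptotics (p : ℕ) (hp : 3 ≤ p) :
    ∃ c : ℝ, ∀ ε : ℝ, 0 < ε → ∃ Q : ℕ, ∀ q : ℕ, Q ≤ q → Nat.Coprime p q →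
      |(countNS p q : ℝ) / (q : ℝ) ^ (p - 1) - c| < ε ∧
      |(countMaxEdim p q : ℝ) / (q : ℝ) ^ (p - 1) - c| < ε := by
  have hlim := tendsto_ncard_div_pow (p := p) (by omega)
  set c := volume.real (kunzPolytope p)
  set F : ℕ → ℕ := fun q => {f : ℕ → ℕ | IsSuperadditiveQuasiperiodic p q f}.ncard
  have hratio : Tendsto (fun q : ℕ => ((q - p : ℕ) : ℝ) / q) atTop (𝓝 1) := by
    have h1 : Tendsto (fun q : ℕ => 1 - (p : ℝ) / q) atTop (𝓝 (1 - 0)) :=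
      tendsto_const_nhds.sub (tendsto_const_div_atTop_nhds_zero_nat (p : ℝ))
    rw [sub_zero] at h1
    refine h1.congr' ?_
    filter_upwards [eventually_ge_atTop p, eventually_gt_atTop 0] with q hq hq0
    have : (q : ℝ) ≠ 0 := by positivity
    rw [Nat.cast_sub hq]
    field_simp
  have hlim' : Tendsto (fun q : ℕ => (F (q - p) : ℝ) / (q : ℝ) ^ (p - 1)) atTop (𝓝 c) := by
    have h2 := (hlim.comp (tendsto_sub_atTop_nat p)).mul (hratio.pow (p - 1))
    rw [one_pow, mul_one] at h2
    refine h2.congr' ?_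
    filter_upwards [eventually_gt_atTop p] with q hq
    have : (((q - p : ℕ) : ℝ)) ≠ 0 := by
      have : q - p ≠ 0 := by omega
      exact_mod_cast this
    have : (q : ℝ) ≠ 0 := by
      have : q ≠ 0 := by omega
      exact_mod_cast this
    simp only [Function.comp_apply, F]
    rw [div_pow]
    field_simp
  refine ⟨c, fun ε hε => ?_⟩
  obtain ⟨Q₁, hQ₁⟩ := Metric.tendsto_atTop.1 hlim ε hε
  obtain ⟨Q₂, hQ₂⟩ := Metric.tendsto_atTop.1 hlim' ε hε
  refine ⟨max (p + 1) (max Q₁ Q₂), fun q hq hpq => ?_⟩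
  simp only [max_le_iff] at hq
  have hcop : p.Coprime (q - p) := (Nat.coprime_sub_self_right (by omega)).2 hpq
  rw [countMaxEdim_eq_countNS (by omega) (by omega), countNS_eq_ncard (by omega) (by omega) hpq,
    countNS_eq_ncard (by omega) (by omega) hcop]
  exact ⟨hQ₁ q hq.2.1, hQ₂ q hq.2.2⟩
end

section
/- For every integer q > 3 with gcd(q,3) = 1 one has N(3,q) = N(3, q−3) + ⌊q/2⌋ + 1, where N(3,q) is the number of numerical semigroups containing both 3 and q. -/
namespace IsNumericalSemigroup

variable {H : Set ℕ} {q n m : ℕ}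

/-- A numerical semigroup containing `3` is closed upwards within each class modulo `3`. -/
theorem mem_of_le_of_mod_eq (hH : IsNumericalSemigroup H) (h3 : 3 ∈ H) (hn : n ∈ H)
    (hle : n ≤ m) (hmod : n % 3 = m % 3) : m ∈ H := by
  have add_three_mul (j : ℕ) : n + 3 * j ∈ H := by
    induction j with
    | zero => simpa using hn
    | succ j ih => exact hH.2.1 _ ih _ h3
  have h := add_three_mul ((m - n) / 3)
  rwa [show n + 3 * ((m - n) / 3) = m by omega] at h

theorem two_mul_mem (hH : IsNumericalSemigroup H) (hn : n ∈ H) : 2 * n ∈ H := by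
  simpa [two_mul] using hH.2.1 n hn n hn

theorem mem_of_two_mul_le (hH : IsNumericalSemigroup H) (h3 : 3 ∈ H) (hq : q ∈ H)
    (hcop : q % 3 ≠ 0) (hn : 2 * q ≤ n) : n ∈ H := by
  have h2q := hH.two_mul_mem hq
  have hcases : 0 % 3 = n % 3 ∨ q % 3 = n % 3 ∨ 2 * q % 3 = n % 3 := by omega
  rcases hcases with h | h | h
  · exact hH.mem_of_le_of_mod_eq h3 hH.1 (by omega) h
  · exact hH.mem_of_le_of_mod_eq h3 hq (by omega) h
  · exact hH.mem_of_le_of_mod_eq h3 h2q hn h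

theorem finite_setOf_three_mem (hcop : q % 3 ≠ 0) :
    {H : Set ℕ | IsNumericalSemigroup H ∧ 3 ∈ H ∧ q ∈ H}.Finite := by
  refine Set.Finite.of_finite_image (f := compl) ?_ compl_injective.injOn
  refine (Set.finite_Iio (2 * q)).finite_subsets.subset ?_
  rintro _ ⟨H, ⟨hH, h3, hq⟩, rfl⟩ n hn
  by_contra h
  exact hn (hH.mem_of_two_mul_le h3 hq hcop (not_lt.mp h))

end IsNumericalSemigroup

/-- The set of naturals whose least elements in the classes of `0`, `q` and `2 * q` modulo `3`
are `0`, `q` and `2 * q - 3 * k`, when `q` is coprime to `3` and `3 * k ≤ 2 * q`. -/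
def aperySemigroup (q k : ℕ) : Set ℕ :=
  {n | n % 3 = 0 ∨ (n % 3 = q % 3 ∧ q ≤ n) ∨ (n % 3 = 2 * q % 3 ∧ 2 * q ≤ n + 3 * k)}

theorem mem_aperySemigroup {q k n : ℕ} : n ∈ aperySemigroup q k ↔
    n % 3 = 0 ∨ (n % 3 = q % 3 ∧ q ≤ n) ∨ (n % 3 = 2 * q % 3 ∧ 2 * q ≤ n + 3 * k) :=
  Iff.rfl

theorem isNumericalSemigroup_aperySemigroup {q k : ℕ} (hcop : q % 3 ≠ 0) (hk : k ≤ q / 2) :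
    IsNumericalSemigroup (aperySemigroup q k) := by
  refine ⟨Or.inl rfl, fun a ha b hb => ?_, (Set.finite_Iio (2 * q)).subset fun n hn => ?_⟩
  · rw [mem_aperySemigroup] at *
    omega
  · rw [Set.mem_compl_iff, mem_aperySemigroup] at hn
    rw [Set.mem_Iio]
    omega

theorem injOn_aperySemigroup {q : ℕ} (hcop : q % 3 ≠ 0) :
    Set.InjOn (aperySemigroup q) (Set.Iic (q / 2)) := by
  intro k hk l hl h
  rw [Set.mem_Iic] at hk hl
  have hmem_k : 2 * q - 3 * k ∈ aperySemigroup q l := by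
    rw [← h, mem_aperySemigroup]
    omega
  have hmem_l : 2 * q - 3 * l ∈ aperySemigroup q k := by
    rw [h, mem_aperySemigroup]
    omega
  rw [mem_aperySemigroup] at hmem_k hmem_l
  omega

theorem IsNumericalSemigroup.exists_eq_aperySemigroup {H : Set ℕ} {q : ℕ}
    (hH : IsNumericalSemigroup H) (h3 : 3 ∈ H) (hq : q ∈ H) (hlt : 3 < q) (hcop : q % 3 ≠ 0)
    (hsub : q - 3 ∉ H) : ∃ k ≤ q / 2, aperySemigroup q k = H := by
  classical
  have h2q := hH.two_mul_mem hq
  set k := Nat.findGreatest (fun k => 2 * q - 3 * k ∈ H) (q / 2)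
  have hk : k ≤ q / 2 := Nat.findGreatest_le _
  have hkH : 2 * q - 3 * k ∈ H :=
    Nat.findGreatest_spec (P := fun k => 2 * q - 3 * k ∈ H) (Nat.zero_le _) (by simpa using h2q)
  refine ⟨k, hk, Set.ext fun n => ⟨?_, fun hn => ?_⟩⟩
  · rintro (h | ⟨h, hle⟩ | ⟨h, hle⟩)
    · exact hH.mem_of_le_of_mod_eq h3 hH.1 (Nat.zero_le _) (by omega)
    · exact hH.mem_of_le_of_mod_eq h3 hq hle h.symm
    · exact hH.mem_of_le_of_mod_eq h3 hkH (by omega) (by omega)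
  · by_contra hnot
    rw [mem_aperySemigroup] at hnot
    by_cases hmod : n % 3 = q % 3
    · exact hsub (hH.mem_of_le_of_mod_eq h3 hn (by omega) (by omega))
    · have hmod' : n % 3 = 2 * q % 3 := by omega
      have hgap : n + 3 * k < 2 * q := by
        by_contra hge
        exact hnot (Or.inr (Or.inr ⟨hmod', not_lt.mp hge⟩))
      obtain ⟨d, hd⟩ : ∃ d, 2 * q = n + 3 * d := ⟨(2 * q - n) / 3, by omega⟩
      have hle : d ≤ q / 2 := by
        by_contra hgt
        exact hsub (hH.mem_of_le_of_mod_eq h3 (hH.two_mul_mem hn) (by omega) (by omega))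
      refine Nat.findGreatest_is_greatest (P := fun k => 2 * q - 3 * k ∈ H)
        (k := d) (by omega) hle ?_
      rwa [hd, Nat.add_sub_cancel]

theorem setOf_three_mem_eq_union {q : ℕ} (hlt : 3 < q) (hcop : q % 3 ≠ 0) :
    {H : Set ℕ | IsNumericalSemigroup H ∧ 3 ∈ H ∧ q ∈ H} =
      {H : Set ℕ | IsNumericalSemigroup H ∧ 3 ∈ H ∧ q - 3 ∈ H} ∪
        aperySemigroup q '' Set.Iic (q / 2) := by
  ext H
  constructor
  · rintro ⟨hH, h3, hq⟩
    by_cases hsub : q - 3 ∈ H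
    · exact Or.inl ⟨hH, h3, hsub⟩
    · exact Or.inr (hH.exists_eq_aperySemigroup h3 hq hlt hcop hsub)
  · rintro (⟨hH, h3, hsub⟩ | ⟨k, hk, rfl⟩)
    · exact ⟨hH, h3, hH.mem_of_le_of_mod_eq h3 hsub (by omega) (by omega)⟩
    · exact ⟨isNumericalSemigroup_aperySemigroup hcop hk, Or.inl rfl, Or.inr (Or.inl ⟨rfl, le_rfl⟩)⟩

theorem disjoint_setOf_three_mem_image_aperySemigroup {q : ℕ} (hlt : 3 < q) (hcop : q % 3 ≠ 0) :
    Disjoint {H : Set ℕ | IsNumericalSemigroup H ∧ 3 ∈ H ∧ q - 3 ∈ H}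
      (aperySemigroup q '' Set.Iic (q / 2)) := by
  rw [Set.disjoint_left]
  rintro _ ⟨-, -, hsub⟩ ⟨k, -, rfl⟩
  rw [mem_aperySemigroup] at hsub
  omega

/-- Recursion formula: `N(3,q) = N(3, q-3) + ⌊q/2⌋ + 1` for `q > 3` coprime to `3`. -/
theorem countNS_three_recursion (q : ℕ) (hq : 3 < q) (hcop : Nat.Coprime q 3) :
    countNS 3 q = countNS 3 (q - 3) + q / 2 + 1 := by
  have hmod : q % 3 ≠ 0 := fun h =>
    absurd (Nat.Coprime.eq_one_of_dvd hcop.symm (Nat.dvd_of_mod_eq_zero h)) (by norm_num)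
  rw [countNS, setOf_three_mem_eq_union hq hmod,
    Set.ncard_union_eq (disjoint_setOf_three_mem_image_aperySemigroup hq hmod)
      (IsNumericalSemigroup.finite_setOf_three_mem (by omega)) ((Set.finite_Iic _).image _),
    (injOn_aperySemigroup hmod).ncard_image, ← Finset.coe_Iic, Set.ncard_coe_finset,
    Nat.card_Iic, countNS, add_assoc]
end

section
/- As q → ∞ along integers coprime to 3, both Sym(3,q)/q → 1/2 and Psym(3,q)/q → 1/2, where Sym(3,q) (resp. Psym(3,q)) is the number of symmetric (resp. pseudo-symmetric) numerical semigroups containing both 3 and q; i.e. for every ε > 0 there is Q such that for all q ≥ Q with gcd(q,3) = 1 one has |Sym(3,q)/q − 1/2| < ε and |Psym(3,q)/q − 1/2| < ε. -/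
/-- The genus: number of gaps. -/
noncomputable def genus (H : Set ℕ) : ℕ := Hᶜ.ncard

/-- The Frobenius number, as an integer (so that F(ℕ) = -1). -/
noncomputable def frobNum (H : Set ℕ) : ℤ :=
  sSup (insert (-1) ((fun n : ℕ => (n : ℤ)) '' Hᶜ))

/-- `H` is symmetric if `2 g(H) = F(H) + 1`. -/
def IsSymmetricNS (H : Set ℕ) : Prop := 2 * (genus H : ℤ) = frobNum H + 1

/-- `H` is pseudo-symmetric if `2 g(H) = F(H) + 2`. -/
def IsPseudoSymmetricNS (H : Set ℕ) : Prop := 2 * (genus H : ℤ) = frobNum H + 2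

/-- `Sym p q`: the number of symmetric numerical semigroups containing both `p` and `q`. -/
noncomputable def countSym (p q : ℕ) : ℕ :=
  {H : Set ℕ | IsNumericalSemigroup H ∧ p ∈ H ∧ q ∈ H ∧ IsSymmetricNS H}.ncard

/-- `Psym p q`: the number of pseudo-symmetric numerical semigroups containing both
`p` and `q`. -/
noncomputable def countPsym (p q : ℕ) : ℕ :=
  {H : Set ℕ | IsNumericalSemigroup H ∧ p ∈ H ∧ q ∈ H ∧ IsPseudoSymmetricNS H}.ncard

/-- The set of naturals having `p.1` gaps (the smallest ones) in the class of `1` modulo `3`, and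
`p.2` gaps in the class of `2`. -/
def threeSet (p : ℕ × ℕ) : Set ℕ :=
  {n | n % 3 = 0 ∨ (n % 3 = 1 ∧ 3 * p.1 + 1 ≤ n) ∨ (n % 3 = 2 ∧ 3 * p.2 + 2 ≤ n)}

theorem mem_threeSet {p : ℕ × ℕ} {n : ℕ} : n ∈ threeSet p ↔
    n % 3 = 0 ∨ (n % 3 = 1 ∧ 3 * p.1 + 1 ≤ n) ∨ (n % 3 = 2 ∧ 3 * p.2 + 2 ≤ n) := Iff.rfl

theorem threeSet_injective : Function.Injective threeSet := by
  rintro ⟨x, y⟩ ⟨x', y'⟩ h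
  have key (n : ℕ) : n ∈ threeSet (x, y) ↔ n ∈ threeSet (x', y') := by rw [h]
  simp only [mem_threeSet] at key
  have h1 := key (3 * x + 1)
  have h2 := key (3 * x' + 1)
  have h3 := key (3 * y + 2)
  have h4 := key (3 * y' + 2)
  ext <;> dsimp only <;> omega

theorem compl_threeSet (p : ℕ × ℕ) :
    (threeSet p)ᶜ = (((Finset.range p.1).image (fun i => 3 * i + 1) ∪
      (Finset.range p.2).image (fun i => 3 * i + 2) : Finset ℕ) : Set ℕ) := by
  ext n
  simp only [Set.mem_compl_iff, mem_threeSet, Finset.coe_union, Finset.coe_image,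
    Finset.coe_range, Set.mem_union, Set.mem_image, Set.mem_Iio]
  constructor
  · intro h
    by_cases h1 : n % 3 = 1
    · exact Or.inl ⟨n / 3, by omega, by omega⟩
    · exact Or.inr ⟨n / 3, by omega, by omega⟩
  · rintro (⟨i, hi, rfl⟩ | ⟨i, hi, rfl⟩) <;> omega

theorem genus_threeSet (p : ℕ × ℕ) : genus (threeSet p) = p.1 + p.2 := by
  rw [genus, compl_threeSet, Set.ncard_coe_finset, Finset.card_union_of_disjoint,
    Finset.card_image_of_injective, Finset.card_image_of_injective, Finset.card_range,
    Finset.card_range]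
  · intro a b h
    dsimp only at h
    omega
  · intro a b h
    dsimp only at h
    omega
  · rw [Finset.disjoint_left]
    intro n hn hn'
    simp only [Finset.mem_image] at hn hn'
    obtain ⟨a, -, ha⟩ := hn
    obtain ⟨b, -, hb⟩ := hn'
    omega

theorem isNumericalSemigroup_threeSet_iff (p : ℕ × ℕ) :
    IsNumericalSemigroup (threeSet p) ↔ p.2 ≤ 2 * p.1 ∧ p.1 ≤ 2 * p.2 + 1 := by
  constructor
  · rintro ⟨-, hadd, -⟩
    have h1 := hadd (3 * p.1 + 1) (by rw [mem_threeSet]; omega) (3 * p.1 + 1)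
      (by rw [mem_threeSet]; omega)
    have h2 := hadd (3 * p.2 + 2) (by rw [mem_threeSet]; omega) (3 * p.2 + 2)
      (by rw [mem_threeSet]; omega)
    rw [mem_threeSet] at h1 h2
    omega
  · rintro ⟨h1, h2⟩
    refine ⟨by simp [mem_threeSet], ?_, ?_⟩
    · intro a ha b hb
      rw [mem_threeSet] at *
      omega
    · rw [compl_threeSet]
      exact Finset.finite_toSet _

theorem frobNum_threeSet (p : ℕ × ℕ) (h : p.2 ≤ 2 * p.1 ∧ p.1 ≤ 2 * p.2 + 1) :
    frobNum (threeSet p) = max (3 * (p.1 : ℤ) - 2) (3 * (p.2 : ℤ) - 1) := by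
  apply IsGreatest.csSup_eq
  constructor
  · by_cases h0 : p.1 = 0 ∧ p.2 = 0
    · left
      omega
    · right
      rcases le_or_gt p.1 p.2 with hle | hlt
      · refine ⟨3 * p.2 - 1, ?_, by dsimp only; omega⟩
        rw [Set.mem_compl_iff, mem_threeSet]
        omega
      · refine ⟨3 * p.1 - 2, ?_, by dsimp only; omega⟩
        rw [Set.mem_compl_iff, mem_threeSet]
        omega
  · rintro z (rfl | ⟨n, hn, rfl⟩)
    · omega
    · rw [Set.mem_compl_iff, mem_threeSet] at hn
      dsimp only
      omega

/-- Within a class modulo `m`, a set stable under adding `m` is an up-set. -/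
theorem add_mul_mem_of_add_mem {H : Set ℕ} {m a : ℕ} (h : ∀ n ∈ H, n + m ∈ H) (ha : a ∈ H)
    (k : ℕ) : a + m * k ∈ H := by
  induction k with
  | zero => simpa using ha
  | succ k ih => simpa [mul_add, ← add_assoc] using h _ ih

theorem exists_mul_add_mem_iff {H : Set ℕ} (hH : IsNumericalSemigroup H) {m : ℕ} (hm : m ∈ H)
    (hpos : 0 < m) (r : ℕ) : ∃ x, ∀ k, m * k + r ∈ H ↔ x ≤ k := by
  classical
  obtain ⟨-, hadd, hfin⟩ := hH
  have hex : ∃ k, m * k + r ∈ H := by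
    by_contra! hne
    refine (Set.infinite_range_of_injective (f := fun k => m * k + r) ?_)
      (hfin.subset (Set.range_subset_iff.2 hne))
    intro a b hab
    simpa [hpos.ne'] using hab
  refine ⟨Nat.find hex, fun k => ⟨fun hk => Nat.find_min' hex hk, fun hk => ?_⟩⟩
  obtain ⟨d, rfl⟩ := Nat.exists_eq_add_of_le hk
  have := add_mul_mem_of_add_mem (fun n hn => hadd n hn m hm) (Nat.find_spec hex) d
  rwa [mul_add, add_right_comm]

theorem exists_eq_threeSet {H : Set ℕ} (hH : IsNumericalSemigroup H) (h3 : 3 ∈ H) :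
    ∃ p, threeSet p = H := by
  obtain ⟨x, hx⟩ := exists_mul_add_mem_iff hH h3 (by norm_num) 1
  obtain ⟨y, hy⟩ := exists_mul_add_mem_iff hH h3 (by norm_num) 2
  refine ⟨(x, y), ?_⟩
  ext n
  rw [mem_threeSet]
  have hn : n = 3 * (n / 3) + n % 3 := (Nat.div_add_mod n 3).symm
  have hlt : n % 3 < 3 := Nat.mod_lt _ (by norm_num)
  generalize n / 3 = k at hn
  generalize hr : n % 3 = r at hn hlt
  subst hn
  interval_cases r
  · have := add_mul_mem_of_add_mem (fun n hn => hH.2.1 n hn 3 h3) hH.1 k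
    simpa using this
  · rw [hx]
    omega
  · rw [hy]
    omega

theorem ncard_numericalSemigroup_three (q : ℕ) (P : Set ℕ → Prop) :
    {H : Set ℕ | IsNumericalSemigroup H ∧ 3 ∈ H ∧ q ∈ H ∧ P H}.ncard =
      {p : ℕ × ℕ | (p.2 ≤ 2 * p.1 ∧ p.1 ≤ 2 * p.2 + 1) ∧ q ∈ threeSet p ∧
        P (threeSet p)}.ncard := by
  rw [← Set.ncard_image_of_injective _ threeSet_injective]
  congr 1
  ext H
  constructor
  · rintro ⟨hH, h3, hq, hP⟩
    obtain ⟨p, rfl⟩ := exists_eq_threeSet hH h3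
    exact ⟨p, ⟨(isNumericalSemigroup_threeSet_iff p).1 hH, hq, hP⟩, rfl⟩
  · rintro ⟨p, ⟨hp, hq, hP⟩, rfl⟩
    exact ⟨(isNumericalSemigroup_threeSet_iff p).2 hp, by simp [mem_threeSet], hq, hP⟩

theorem isSymmetricNS_threeSet_iff (p : ℕ × ℕ) (h : p.2 ≤ 2 * p.1 ∧ p.1 ≤ 2 * p.2 + 1) :
    IsSymmetricNS (threeSet p) ↔ p.1 = 2 * p.2 + 1 ∨ p.2 = 2 * p.1 := by
  rw [IsSymmetricNS, genus_threeSet, frobNum_threeSet p h]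
  omega

theorem isPseudoSymmetricNS_threeSet_iff (p : ℕ × ℕ)
    (h : p.2 ≤ 2 * p.1 ∧ p.1 ≤ 2 * p.2 + 1) :
    IsPseudoSymmetricNS (threeSet p) ↔
      (p.1 = 2 * p.2 ∧ 1 ≤ p.2) ∨ p.2 + 1 = 2 * p.1 := by
  rw [IsPseudoSymmetricNS, genus_threeSet, frobNum_threeSet p h]
  omega

theorem ncard_image_Iio_union_image_Iio {α : Type*} {f g : ℕ → α} (hf : Function.Injective f)
    (hg : Function.Injective g) (hfg : ∀ i j, f i ≠ g j) (a b : ℕ) :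
    (f '' Set.Iio a ∪ g '' Set.Iio b).ncard = a + b := by
  rw [Set.ncard_union_eq _ ((Set.finite_Iio a).image f) ((Set.finite_Iio b).image g),
    Set.ncard_image_of_injective _ hf, Set.ncard_image_of_injective _ hg]
  · simp [← Finset.coe_Iio]
  · rw [Set.disjoint_left]
    rintro _ ⟨i, -, rfl⟩ ⟨j, -, h⟩
    exact hfg i j h.symm

/-- The symmetric semigroups containing `3` and `q` are `⟨3, 3 * i + 2⟩` and `⟨3, 3 * i + 1⟩`. -/
theorem countSym_three_eq (q a b : ℕ)
    (ha : ∀ i, q ∈ threeSet (2 * i + 1, i) ↔ i < a) (hb : ∀ i, q ∈ threeSet (i, 2 * i) ↔ i < b) :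
    countSym 3 q = a + b := by
  rw [countSym, ncard_numericalSemigroup_three, ← ncard_image_Iio_union_image_Iio
    (f := fun i : ℕ => (2 * i + 1, i)) (g := fun i : ℕ => (i, 2 * i))
    (fun i j h => (Prod.ext_iff.1 h).2) (fun i j h => (Prod.ext_iff.1 h).1)
    (fun i j h => by simp only [Prod.mk.injEq] at h; omega)]
  congr 1
  ext ⟨x, y⟩
  constructor
  · rintro ⟨hp, hq, hs⟩
    rcases (isSymmetricNS_threeSet_iff _ hp).1 hs with h | h <;> dsimp only at h <;> subst h
    · exact Or.inl ⟨y, (ha y).1 hq, rfl⟩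
    · exact Or.inr ⟨x, (hb x).1 hq, rfl⟩
  · rintro (⟨i, hi, h⟩ | ⟨i, hi, h⟩) <;> rw [← h]
    · have hp : i ≤ 2 * (2 * i + 1) ∧ 2 * i + 1 ≤ 2 * i + 1 := by omega
      exact ⟨hp, (ha i).2 hi, (isSymmetricNS_threeSet_iff (2 * i + 1, i) hp).2 (Or.inl rfl)⟩
    · have hp : 2 * i ≤ 2 * i ∧ i ≤ 2 * (2 * i) + 1 := by omega
      exact ⟨hp, (hb i).2 hi, (isSymmetricNS_threeSet_iff (i, 2 * i) hp).2 (Or.inr rfl)⟩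

theorem countPsym_three_eq (q a b : ℕ)
    (ha : ∀ i, q ∈ threeSet (2 * (i + 1), i + 1) ↔ i < a)
    (hb : ∀ i, q ∈ threeSet (i + 1, 2 * i + 1) ↔ i < b) :
    countPsym 3 q = a + b := by
  rw [countPsym, ncard_numericalSemigroup_three, ← ncard_image_Iio_union_image_Iio
    (f := fun i : ℕ => (2 * (i + 1), i + 1)) (g := fun i : ℕ => (i + 1, 2 * i + 1))
    (fun i j h => Nat.succ_injective (Prod.ext_iff.1 h).2)
    (fun i j h => Nat.succ_injective (Prod.ext_iff.1 h).1)
    (fun i j h => by simp only [Prod.mk.injEq] at h; omega)]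
  congr 1
  ext ⟨x, y⟩
  constructor
  · rintro ⟨hp, hq, hs⟩
    rcases (isPseudoSymmetricNS_threeSet_iff _ hp).1 hs with ⟨h, h1⟩ | h <;> dsimp only at h
    · obtain ⟨i, rfl⟩ : ∃ i, y = i + 1 := Nat.exists_eq_add_of_le' h1
      subst h
      exact Or.inl ⟨i, (ha i).1 hq, rfl⟩
    · obtain ⟨i, rfl⟩ : ∃ i, x = i + 1 := Nat.exists_eq_add_of_le' (by omega)
      obtain rfl : y = 2 * i + 1 := by omega
      exact Or.inr ⟨i, (hb i).1 hq, rfl⟩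
  · rintro (⟨i, hi, h⟩ | ⟨i, hi, h⟩) <;> rw [← h]
    · have hp : i + 1 ≤ 2 * (2 * (i + 1)) ∧ 2 * (i + 1) ≤ 2 * (i + 1) + 1 := by omega
      exact ⟨hp, (ha i).2 hi, (isPseudoSymmetricNS_threeSet_iff (2 * (i + 1), i + 1) hp).2
        (Or.inl ⟨rfl, Nat.le_add_left 1 i⟩)⟩
    · have hp : 2 * i + 1 ≤ 2 * (i + 1) ∧ i + 1 ≤ 2 * (2 * i + 1) + 1 := by omega
      exact ⟨hp, (hb i).2 hi, (isPseudoSymmetricNS_threeSet_iff (i + 1, 2 * i + 1) hp).2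
        (Or.inr (by dsimp only; ring))⟩

theorem count_three_bounds {q : ℕ} (hq : Nat.Coprime q 3) :
    (q ≤ 2 * countSym 3 q ∧ 2 * countSym 3 q ≤ q + 2) ∧
      (q ≤ 2 * countPsym 3 q + 2 ∧ 2 * countPsym 3 q ≤ q) := by
  have h3 : ¬ 3 ∣ q := (Nat.Prime.coprime_iff_not_dvd Nat.prime_three).1 hq.symm
  have hmod : q % 3 = 1 ∨ q % 3 = 2 := by omega
  rcases hmod with h | h
  · rw [countSym_three_eq q ((q / 3 + 1) / 2) (q / 3 + 1), countPsym_three_eq q (q / 3 / 2) (q / 3)]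
    · omega
    all_goals
      intro i
      simp only [mem_threeSet]
      omega
  · rw [countSym_three_eq q (q / 3 + 1) (q / 3 / 2 + 1),
      countPsym_three_eq q (q / 3) ((q / 3 + 1) / 2)]
    · omega
    all_goals
      intro i
      simp only [mem_threeSet]
      omega

theorem abs_div_sub_half_lt {c q ε : ℝ} (hq : 0 < q) (hε : 1 < ε * q) (hl : q ≤ 2 * c + 2)
    (hu : 2 * c ≤ q + 2) : |c / q - 1 / 2| < ε := by
  have h : c / q - 1 / 2 = (c - q / 2) / q := by field_simp
  rw [h, abs_div, abs_of_pos hq, div_lt_iff₀ hq]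
  refine lt_of_le_of_lt ?_ hε
  rw [abs_le]
  constructor <;> linarith

/-- `Sym(3,q)/q → 1/2` and `Psym(3,q)/q → 1/2` as `q → ∞` along integers coprime to `3`. -/
theorem countSym_countPsym_three_limit :
    ∀ ε : ℝ, 0 < ε → ∃ Q : ℕ, ∀ q : ℕ, Q ≤ q → Nat.Coprime q 3 →
      |(countSym 3 q : ℝ) / (q : ℝ) - 1 / 2| < ε ∧
      |(countPsym 3 q : ℝ) / (q : ℝ) - 1 / 2| < ε := by
  intro ε hε
  obtain ⟨Q, hQ⟩ := exists_nat_gt (1 / ε)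
  refine ⟨Q, fun q hq hcop => ?_⟩
  obtain ⟨⟨h1, h2⟩, h3, h4⟩ := count_three_bounds hcop
  have hlt : 1 / ε < q := hQ.trans_le (by exact_mod_cast hq)
  have hq0 : (0 : ℝ) < q := (one_div_pos.2 hε).trans hlt
  have hεq : 1 < ε * q := by rwa [div_lt_iff₀' hε] at hlt
  constructor <;> apply abs_div_sub_half_lt hq0 hεq <;> norm_cast <;> omega
end
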